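/- Let α ≥ β ≥ 0 and c > d ≥ 0 be integers with β ≥ c. Then for every integer j ≥ 1: I_j((c,d),(α,β)) = −p³ if 1 ≤ j < d; = p² − p³ if j = d; = p² if d + 1 ≤ j < c; = (1 + p²)(1 − p^{−1}) if j = c; and = 1 if j > c. (When d = 0 the case j = d does not occur, since j ≥ 1.) -/

import Mathlib

/-- The symbol `[u,v]` of Hironaka, for integers `u ≥ v ≥ 0`. -/
noncomputable def bsym (p u v : ℕ) : ℚ :=
  (∏ i ∈ Finset.Icc 1 u, (1 - (-(p : ℚ))⁻¹ ^ i)) /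
    ((∏ i ∈ Finset.Icc 1 v, (1 - (-(p : ℚ))⁻¹ ^ i)) *
      (∏ i ∈ Finset.Icc 1 (u - v), (1 - (-(p : ℚ))⁻¹ ^ i)))

/-- For a pair `a = (a₁, a₂)`, the quantity `a'_i = #{j ∈ {1,2} : a_j ≥ i}`. -/
def dualCt (a : ℕ × ℕ) (i : ℕ) : ℕ :=
  (if i ≤ a.1 then 1 else 0) + (if i ≤ a.2 then 1 else 0)

/-- Hironaka's local factor `I_j(μ, λ)`, for pairs `μ = (c,d)`, `λ = (λ₁,λ₂)`. -/
noncomputable def hirI (p : ℕ) (μ lam : ℕ × ℕ) (j : ℕ) : ℚ :=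
  ∑ i ∈ Finset.Icc (dualCt μ (j + 1))
      (min (dualCt (lam.1 + 1, lam.2 + 1) (j + 1)) (dualCt μ j)),
    (-(p : ℚ)) ^ (i * (2 * dualCt (lam.1 + 1, lam.2 + 1) (j + 1) + 1 - i) / 2) *
      bsym p (dualCt (lam.1 + 1, lam.2 + 1) (j + 1) - dualCt μ (j + 1))
        (dualCt (lam.1 + 1, lam.2 + 1) (j + 1) - i) *
      bsym p (dualCt (lam.1 + 1, lam.2 + 1) j - i)
        (dualCt (lam.1 + 1, lam.2 + 1) j - dualCt μ j)

theorem one_sub_inv_neg_pow_ne_zero {p : ℕ} (hp : 1 < p) {i : ℕ} (hi : 1 ≤ i) :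
    1 - (-(p : ℚ))⁻¹ ^ i ≠ 0 := by
  have hp' : (1 : ℚ) < p := by exact_mod_cast hp
  have h : |(-(p : ℚ))⁻¹ ^ i| < 1 := by
    rw [abs_pow, abs_inv, abs_neg, Nat.abs_cast]
    exact pow_lt_one₀ (by positivity) (inv_lt_one_of_one_lt₀ hp') (by omega)
  intro h0
  rw [← sub_eq_zero.mp h0, abs_one] at h
  exact lt_irrefl _ h

theorem prod_one_sub_inv_neg_pow_ne_zero {p : ℕ} (hp : 1 < p) (u : ℕ) :
    ∏ i ∈ Finset.Icc 1 u, (1 - (-(p : ℚ))⁻¹ ^ i) ≠ 0 :=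
  Finset.prod_ne_zero_iff.mpr fun _ hi =>
    one_sub_inv_neg_pow_ne_zero hp (Finset.mem_Icc.mp hi).1

theorem bsym_self {p : ℕ} (hp : 1 < p) (u : ℕ) : bsym p u u = 1 := by
  simpa [bsym] using div_self (prod_one_sub_inv_neg_pow_ne_zero hp u)

theorem bsym_zero_right {p : ℕ} (hp : 1 < p) (u : ℕ) : bsym p u 0 = 1 := by
  simpa [bsym] using div_self (prod_one_sub_inv_neg_pow_ne_zero hp u)

theorem bsym_two_one {p : ℕ} (hp : 1 < p) : bsym p 2 1 = 1 - (p : ℚ)⁻¹ := by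
  have h : 1 - (-(p : ℚ))⁻¹ ≠ 0 := by
    simpa using one_sub_inv_neg_pow_ne_zero hp le_rfl
  have h2 : Finset.Icc 1 2 = {1, 2} := rfl
  rw [bsym, h2]
  simp only [Finset.prod_pair (show (1 : ℕ) ≠ 2 by decide), Finset.Icc_self,
    Finset.prod_singleton, Nat.add_one_sub_one, pow_one]
  rw [div_eq_iff (mul_ne_zero h h), inv_neg]
  ring

theorem dualCt_eq_two {a : ℕ × ℕ} {i : ℕ} (h₁ : i ≤ a.1) (h₂ : i ≤ a.2) :
    dualCt a i = 2 := by
  simp [dualCt, h₁, h₂]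

theorem dualCt_eq_one {a : ℕ × ℕ} {i : ℕ} (h₁ : i ≤ a.1) (h₂ : a.2 < i) :
    dualCt a i = 1 := by
  simp [dualCt, h₁, h₂]

theorem dualCt_eq_zero {a : ℕ × ℕ} {i : ℕ} (h₁ : a.1 < i) (h₂ : a.2 < i) :
    dualCt a i = 0 := by
  simp [dualCt, h₁, h₂]

theorem statement8 (p : ℕ) (hp : p.Prime) (hodd : Odd p)
    (α β c d : ℕ) (hβα : β ≤ α) (hdc : d < c) (hcβ : c ≤ β)
    (j : ℕ) (hj : 1 ≤ j) :
    (j < d → hirI p (c, d) (α, β) j = -(p : ℚ) ^ 3) ∧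
    (j = d → hirI p (c, d) (α, β) j = (p : ℚ) ^ 2 - (p : ℚ) ^ 3) ∧
    (d + 1 ≤ j ∧ j < c → hirI p (c, d) (α, β) j = (p : ℚ) ^ 2) ∧
    (j = c → hirI p (c, d) (α, β) j = (1 + (p : ℚ) ^ 2) * (1 - (p : ℚ)⁻¹)) ∧
    (c < j → hirI p (c, d) (α, β) j = 1) := by
  have hp1 := hp.one_lt
  have hlam {k : ℕ} (hk : k ≤ β + 1) : dualCt (α + 1, β + 1) k = 2 :=
    dualCt_eq_two (by simp only; omega) hk
  have h12 : Finset.Icc 1 2 = {1, 2} := rfl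
  have h01 : Finset.Icc 0 1 = {0, 1} := rfl
  refine ⟨fun h => ?_, fun h => ?_, fun h => ?_, fun h => ?_, fun h => ?_⟩
  · have hμ : dualCt (c, d) j = 2 := dualCt_eq_two (by simp only; omega) (by simp only; omega)
    have hμ' : dualCt (c, d) (j + 1) = 2 :=
      dualCt_eq_two (by simp only; omega) (by simp only; omega)
    simp [hirI, hμ, hμ', hlam (show j ≤ β + 1 by omega), hlam (show j + 1 ≤ β + 1 by omega),
      bsym_self hp1]
    ring
  · have hμ : dualCt (c, d) j = 2 := dualCt_eq_two (by simp only; omega) (by simp only; omega)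
    have hμ' : dualCt (c, d) (j + 1) = 1 :=
      dualCt_eq_one (by simp only; omega) (by simp only; omega)
    simp [hirI, hμ, hμ', hlam (show j ≤ β + 1 by omega), hlam (show j + 1 ≤ β + 1 by omega),
      bsym_self hp1, bsym_zero_right hp1, h12]
    ring
  · have hμ : dualCt (c, d) j = 1 := dualCt_eq_one (by simp only; omega) (by simp only; omega)
    have hμ' : dualCt (c, d) (j + 1) = 1 :=
      dualCt_eq_one (by simp only; omega) (by simp only; omega)
    simp [hirI, hμ, hμ', hlam (show j ≤ β + 1 by omega), hlam (show j + 1 ≤ β + 1 by omega),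
      bsym_self hp1]
  · have hμ : dualCt (c, d) j = 1 := dualCt_eq_one (by simp only; omega) (by simp only; omega)
    have hμ' : dualCt (c, d) (j + 1) = 0 :=
      dualCt_eq_zero (by simp only; omega) (by simp only; omega)
    simp [hirI, hμ, hμ', hlam (show j ≤ β + 1 by omega), hlam (show j + 1 ≤ β + 1 by omega),
      bsym_self hp1, bsym_two_one hp1, h01]
    ring
  · have hμ : dualCt (c, d) j = 0 := dualCt_eq_zero (by simp only; omega) (by simp only; omega)
    have hμ' : dualCt (c, d) (j + 1) = 0 :=
      dualCt_eq_zero (by simp only; omega) (by simp only; omega)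
    simp [hirI, hμ, hμ', bsym_self hp1]
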